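/- Let A be a module over a ring and N : A → A a nilpotent module endomorphism. Define M_k = Σ_{p,q ≥ 0, p−q = k} (ker N^{p+1}) ∩ (image of N^q) for k ∈ ℤ. Then (M_k) is an increasing filtration of A by submodules satisfying N(M_k) ⊆ M_{k-2} for all k and, for every i ≥ 0, N^i induces an isomorphism M_i/M_{i-1} ≅ M_{-i}/M_{-i-1}; that is, (M_k) is the monodromy filtration of N. -/

import Mathlib

/-!
STATEMENT 7: Let `A` be a module over a ring and `N : A → A` a nilpotent module
endomorphism.  Define `M_k = Σ_{p,q ≥ 0, p−q = k} (ker N^{p+1}) ∩ (im N^q)`.  Then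
`(M_k)` is an increasing filtration of `A` by submodules satisfying `N(M_k) ⊆ M_{k-2}`
and, for every `i ≥ 0`, `N^i` induces an isomorphism `M_i/M_{i-1} ≅ M_{-i}/M_{-i-1}`;
that is, `(M_k)` is the monodromy filtration of `N`.
-/

/-- `N^i` induces an isomorphism `F i / F (i-1) ≅ F (-i) / F (-i-1)`, stated elementwise. -/
def InducesIso {R A : Type*} [Ring R] [AddCommGroup A] [Module R A]
    (N : A →ₗ[R] A) (F : ℤ → Submodule R A) (i : ℕ) : Prop :=
  (∀ x ∈ F (i : ℤ), (N ^ i) x ∈ F (-(i : ℤ))) ∧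
  (∀ y ∈ F (-(i : ℤ)), ∃ x ∈ F (i : ℤ), y - (N ^ i) x ∈ F (-(i : ℤ) - 1)) ∧
  (∀ x ∈ F (i : ℤ), (N ^ i) x ∈ F (-(i : ℤ) - 1) → x ∈ F ((i : ℤ) - 1))

/-- The candidate monodromy filtration
`M_k = Σ_{p,q ≥ 0, p−q = k} (ker N^{p+1}) ∩ (range N^q)`. -/
def Mfil {R A : Type*} [Ring R] [AddCommGroup A] [Module R A]
    (N : A →ₗ[R] A) (k : ℤ) : Submodule R A :=
  ⨆ p : ℕ, ⨆ q : ℕ, ⨆ _ : (p : ℤ) - (q : ℤ) = k,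
    LinearMap.ker (N ^ (p + 1)) ⊓ LinearMap.range (N ^ q)

section Mfil

variable {R A : Type*} [Ring R] [AddCommGroup A] [Module R A] {N : A →ₗ[R] A}

theorem mem_Mfil {k : ℤ} {p q : ℕ} (h : (p : ℤ) - q = k) {x : A}
    (hp : (N ^ (p + 1)) x = 0) (hq : x ∈ LinearMap.range (N ^ q)) : x ∈ Mfil N k :=
  Submodule.mem_iSup_of_mem p <| Submodule.mem_iSup_of_mem q <|
    Submodule.mem_iSup_of_mem h ⟨LinearMap.mem_ker.2 hp, hq⟩

theorem Mfil_le {k : ℤ} {S : Submodule R A}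
    (h : ∀ (p q : ℕ) (z : A), (p : ℤ) - q = k → (N ^ (p + 1 + q)) z = 0 → (N ^ q) z ∈ S) :
    Mfil N k ≤ S := by
  refine iSup_le fun p => iSup_le fun q => iSup_le fun hk => ?_
  rintro _ ⟨hp, z, rfl⟩
  refine h p q z hk ?_
  rw [pow_add]
  exact hp

theorem Mfil_sub_one_le (k : ℤ) : Mfil N (k - 1) ≤ Mfil N k := by
  refine Mfil_le fun p q z hk hz => mem_Mfil (p := p + 1) (q := q) (by lia) ?_ ⟨z, rfl⟩
  rw [← Module.End.mul_apply, ← pow_add, show p + 1 + 1 + q = 1 + (p + 1 + q) by lia, pow_add,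
    Module.End.mul_apply, hz, map_zero]

theorem Mfil_eq_bot {m : ℕ} (hm : N ^ m = 0) {k : ℤ} (hk : k ≤ -m) : Mfil N k = ⊥ := by
  refine le_bot_iff.1 <| Mfil_le fun p q z h _ => ?_
  rw [pow_eq_zero_of_le (by lia : m ≤ q) hm]
  exact zero_mem _

theorem Mfil_eq_top {m : ℕ} (hm : N ^ m = 0) {k : ℤ} (hk : m ≤ k) : Mfil N k = ⊤ := by
  refine eq_top_iff.2 fun x _ => mem_Mfil (p := k.toNat) (q := 0) (by lia) ?_ ⟨x, rfl⟩
  rw [pow_eq_zero_of_le (by lia : m ≤ k.toNat + 1) hm, LinearMap.zero_apply]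

theorem map_Mfil_le (k : ℤ) : (Mfil N k).map N ≤ Mfil N (k - 2) := by
  refine Submodule.map_le_iff_le_comap.2 <| Mfil_le fun p q z hk hz => ?_
  rw [Submodule.mem_comap, ← Module.End.mul_apply, ← pow_succ']
  rcases p with _ | p
  · rw [show q + 1 = 0 + 1 + q by lia, hz]
    exact zero_mem _
  · refine mem_Mfil (p := p) (q := q + 1) (by lia) ?_ ⟨z, rfl⟩
    rw [← Module.End.mul_apply, ← pow_add, ← hz]
    congr 2
    lia

theorem pow_apply_mem_Mfil (i : ℕ) {k : ℤ} {x : A} (hx : x ∈ Mfil N k) :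
    (N ^ i) x ∈ Mfil N (k - 2 * i) := by
  induction i with
  | zero => simpa using hx
  | succ i ih =>
    rw [pow_succ', Module.End.mul_apply, show k - 2 * (i + 1 : ℕ) = k - 2 * i - 2 by lia]
    exact map_Mfil_le _ ⟨_, ih, rfl⟩

theorem Mfil_le_map_pow {i : ℕ} {k : ℤ} (hk : k + i ≤ 0) :
    Mfil N k ≤ (Mfil N (k + 2 * i)).map (N ^ i) := by
  refine Mfil_le fun p q z h hz => ?_
  obtain ⟨r, rfl⟩ := Nat.exists_eq_add_of_le (by lia : i ≤ q)
  refine ⟨(N ^ r) z, mem_Mfil (p := p + i) (q := r) (by lia) ?_ ⟨z, rfl⟩, ?_⟩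
  · rw [← Module.End.mul_apply, ← pow_add, ← hz]
    congr 2
    lia
  · rw [← Module.End.mul_apply, ← pow_add]

theorem ker_pow_le_Mfil (i : ℕ) : LinearMap.ker (N ^ i) ≤ Mfil N ((i : ℤ) - 1) := by
  intro x hx
  rcases i with _ | i
  · obtain rfl : x = 0 := by simpa using hx
    exact zero_mem _
  · exact mem_Mfil (p := i) (q := 0) (by lia) hx ⟨x, rfl⟩

theorem inducesIso_Mfil (i : ℕ) : InducesIso N (Mfil N) i := by
  refine ⟨fun x hx => ?_, fun y hy => ?_, fun x _ hx => ?_⟩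
  · convert pow_apply_mem_Mfil i hx using 2
    lia
  · obtain ⟨x, hx, rfl⟩ := Mfil_le_map_pow (i := i) (by lia) hy
    rw [show -(i : ℤ) + 2 * i = i by lia] at hx
    refine ⟨x, hx, ?_⟩
    rw [sub_self]
    exact zero_mem _
  · obtain ⟨w, hw, hwx⟩ := Mfil_le_map_pow (i := i) (by lia) hx
    rw [show -(i : ℤ) - 1 + 2 * i = i - 1 by lia] at hw
    rw [← sub_add_cancel x w]
    refine add_mem (ker_pow_le_Mfil i ?_) hw
    rw [LinearMap.mem_ker, map_sub, hwx, sub_self]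

end Mfil

theorem stmt_7 {R A : Type*} [Ring R] [AddCommGroup A] [Module R A]
    (N : A →ₗ[R] A) (hN : ∃ m : ℕ, 0 < m ∧ N ^ m = 0) :
    (∀ k : ℤ, Mfil N (k - 1) ≤ Mfil N k) ∧
    (∃ a : ℤ, ∀ i ≤ a, Mfil N i = ⊥) ∧
    (∃ b : ℤ, ∀ i, b ≤ i → Mfil N i = ⊤) ∧
    (∀ k : ℤ, (Mfil N k).map N ≤ Mfil N (k - 2)) ∧
    (∀ i : ℕ, InducesIso N (Mfil N) i) := by
  obtain ⟨m, -, hm⟩ := hN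
  exact ⟨Mfil_sub_one_le, ⟨-m, fun _ => Mfil_eq_bot hm⟩, ⟨m, fun _ => Mfil_eq_top hm⟩,
    map_Mfil_le, inducesIso_Mfil⟩
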